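/- Let K ⊆ ℝⁿ be a convex body, let c > 0, suppose K is a Minkowski summand of cB (there exists a convex body M with M + K = cB), and let P be a real polynomial of degree at most n with P(t) = vol(K + tB) for all real t ≥ 0. Then for all real t ≥ 0, vol((cB ∼ K) + tB) = (−1)ⁿ · P(−t − c). That is, the Steiner polynomial of the body K' = cB ∼ K satisfies S_{K'}(t) = (−1)ⁿ S_K(−t − c). -/

import Mathlib

open MeasureTheory Metric Pointwise

/-- The Minkowski difference `K ∼ L = { v : L + v ⊆ K }`. -/
def minkowskiDiff {n : ℕ} (K L : Set (EuclideanSpace ℝ (Fin n))) :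
    Set (EuclideanSpace ℝ (Fin n)) :=
  {v | L + {v} ⊆ K}

open Set Filter Topology
open scoped RealInnerProductSpace NNReal ENNReal

/-- `P` is a nearest point map of the set `K`, in terms of the variational inequality. -/
def IsNearestPointMap {E : Type*} [NormedAddCommGroup E] [InnerProductSpace ℝ E]
    (K : Set E) (P : E → E) : Prop :=
  ∀ x, P x ∈ K ∧ ∀ y ∈ K, ⟪x - P x, y - P x⟫ ≤ 0

section NearestPoint

variable {E : Type*} [NormedAddCommGroup E] [InnerProductSpace ℝ E] {K : Set E} {P : E → E}

theorem exists_isNearestPointMap (hne : K.Nonempty) (hK : IsCompact K) (hconv : Convex ℝ K) :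
    ∃ P : E → E, IsNearestPointMap K P := by
  choose P hP using exists_norm_eq_iInf_of_complete_convex hne hK.isComplete hconv
  exact ⟨P, fun x => ⟨(hP x).1,
    (norm_eq_iInf_iff_real_inner_le_zero hconv (hP x).1).1 (hP x).2⟩⟩

theorem IsNearestPointMap.norm_sq_le_inner (hP : IsNearestPointMap K P) (x y : E) :
    ‖P x - P y‖ ^ 2 ≤ ⟪P x - P y, x - y⟫ := by
  have h1 := (hP x).2 _ (hP y).1
  have h2 := (hP y).2 _ (hP x).1
  rw [← real_inner_self_eq_norm_sq]
  simp only [inner_sub_left, inner_sub_right] at h1 h2 ⊢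
  linarith [real_inner_comm x (P x), real_inner_comm x (P y), real_inner_comm y (P x),
    real_inner_comm y (P y), real_inner_comm (P x) (P y)]

theorem IsNearestPointMap.inner_nonneg (hP : IsNearestPointMap K P) (x y : E) :
    0 ≤ ⟪P x - P y, x - y⟫ :=
  (sq_nonneg _).trans (hP.norm_sq_le_inner x y)

theorem IsNearestPointMap.lipschitzWith (hP : IsNearestPointMap K P) : LipschitzWith 1 P := by
  refine LipschitzWith.of_dist_le_mul fun x y => ?_
  rw [dist_eq_norm, dist_eq_norm, NNReal.coe_one, one_mul]
  have h := (hP.norm_sq_le_inner x y).trans (real_inner_le_norm _ _)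
  by_contra! hlt
  nlinarith [norm_nonneg (x - y)]

/-- The function `x ↦ ⟪x, P x⟫ - ‖P x‖² / 2`, a convex potential of the nearest point map `P`. -/
noncomputable def nearestPointPotential (P : E → E) (x : E) : ℝ :=
  ⟪x, P x⟫ - ‖P x‖ ^ 2 / 2

theorem IsNearestPointMap.le_potential (hP : IsNearestPointMap K P) (x : E) {y : E} (hy : y ∈ K) :
    ⟪x, y⟫ - ‖y‖ ^ 2 / 2 ≤ nearestPointPotential P x := by
  have h := (hP x).2 y hy
  have h2 := sq_nonneg ‖y - P x‖
  simp only [nearestPointPotential, ← real_inner_self_eq_norm_sq] at h2 ⊢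
  simp only [inner_sub_left, inner_sub_right] at h h2
  linarith [real_inner_comm y (P x)]

theorem IsNearestPointMap.potential_sub_le (hP : IsNearestPointMap K P) (x y : E) :
    nearestPointPotential P x - nearestPointPotential P y ≤ ⟪P x, x - y⟫ := by
  have h := hP.le_potential y (hP x).1
  rw [nearestPointPotential, inner_sub_right]
  linarith [real_inner_comm x (P x), real_inner_comm y (P x)]

theorem IsNearestPointMap.continuous_potential (hP : IsNearestPointMap K P) :
    Continuous (nearestPointPotential P) := by
  have := hP.lipschitzWith.continuous
  unfold nearestPointPotential
  fun_prop

end NearestPoint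

section MonotoneMap

variable {E : Type*} [NormedAddCommGroup E] [InnerProductSpace ℝ E]

/-- **Minty's lemma** for everywhere defined continuous maps. -/
theorem eq_of_forall_inner_nonneg {F : E → E} (hF : Continuous F) {x z : E}
    (h : ∀ y, 0 ≤ ⟪F y - z, y - x⟫) : F x = z := by
  have key : ∀ v, 0 ≤ ⟪F x - z, v⟫ := by
    intro v
    have hlim : Tendsto (fun s : ℝ => ⟪F (x + s • v) - z, v⟫) (𝓝[>] 0) (𝓝 ⟪F x - z, v⟫) := by
      have hc : Continuous (fun s : ℝ => ⟪F (x + s • v) - z, v⟫) := by fun_prop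
      have := hc.tendsto 0
      simp only [zero_smul, add_zero] at this
      exact this.mono_left nhdsWithin_le_nhds
    refine ge_of_tendsto hlim ?_
    filter_upwards [self_mem_nhdsWithin] with s hs
    have hs' : (0 : ℝ) < s := hs
    have := h (x + s • v)
    rw [add_sub_cancel_left, inner_smul_right] at this
    exact nonneg_of_mul_nonneg_right this hs'
  have h1 := key (-(F x - z))
  rw [inner_neg_right] at h1
  have h2 : ⟪F x - z, F x - z⟫ = 0 :=
    le_antisymm (by linarith) real_inner_self_nonneg
  exact sub_eq_zero.1 (inner_self_eq_zero.1 h2)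

/-- The fibres of a continuous monotone map are star-shaped around each of their points. -/
theorem apply_add_smul_eq_of_monotone {F : E → E} (hF : Continuous F)
    (hmono : ∀ x y, 0 ≤ ⟪F x - F y, x - y⟫) {x y : E} (hxy : F x = F y) {s : ℝ}
    (hs0 : 0 ≤ s) (hs1 : s ≤ 1) : F (x + s • (y - x)) = F x := by
  refine eq_of_forall_inner_nonneg hF fun w => ?_
  have h1 := hmono w x
  have h2 := hmono w y
  rw [← hxy] at h2
  have : w - (x + s • (y - x)) = (1 - s) • (w - x) + s • (w - y) := by module
  rw [this, inner_add_right, inner_smul_right, inner_smul_right]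
  have := mul_nonneg (sub_nonneg.2 hs1) h1
  have := mul_nonneg hs0 h2
  linarith

theorem inner_fderiv_nonneg_of_monotone {F : E → E} {F' : E →L[ℝ] E} {x : E}
    (hmono : ∀ x y, 0 ≤ ⟪F x - F y, x - y⟫) (hF : HasFDerivAt F F' x) (v : E) :
    0 ≤ ⟪F' v, v⟫ := by
  have h := (hF.lim_real v).inner (𝕜 := ℝ) (tendsto_const_nhds (x := v))
  refine ge_of_tendsto h ?_
  filter_upwards [eventually_gt_atTop 0] with c hc
  have := hmono (x + c⁻¹ • v) x
  rw [add_sub_cancel_left, inner_smul_right] at this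
  rw [inner_smul_left]
  exact mul_nonneg hc.le (nonneg_of_mul_nonneg_right this (inv_pos.2 hc))

theorem det_nonneg_of_inner_nonneg [FiniteDimensional ℝ E] {A : E →L[ℝ] E}
    (hA : ∀ v, 0 ≤ ⟪A v, v⟫) : 0 ≤ A.det := by
  by_contra! hneg
  let p : ℝ → ℝ := fun t => ((1 - t) • A + t • ContinuousLinearMap.id ℝ E).det
  have hp : Continuous p := ContinuousLinearMap.continuous_det.comp (by fun_prop)
  have hp0 : p 0 = A.det := by simp [p]
  have hp1 : p 1 = 1 := by simp [p, ContinuousLinearMap.det]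
  obtain ⟨t, ⟨ht0, ht1⟩, ht⟩ : (0 : ℝ) ∈ p '' Icc 0 1 :=
    intermediate_value_Icc zero_le_one hp.continuousOn ⟨by rw [hp0]; exact hneg.le, by simp [hp1]⟩
  have htpos : 0 < t := lt_of_le_of_ne ht0 fun h => by
    rw [← h, hp0] at ht
    exact hneg.ne ht
  obtain ⟨v, hv, hv0⟩ := Submodule.exists_mem_ne_zero_of_ne_bot
    (LinearMap.bot_lt_ker_of_det_eq_zero ht).ne'
  have hv' : (1 - t) • A v + t • v = 0 := hv
  have h := congrArg (fun w => ⟪w, v⟫) hv'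
  simp only [inner_add_left, inner_smul_left, inner_zero_left, conj_trivial] at h
  have h1 := mul_nonneg (sub_nonneg.2 ht1) (hA v)
  have h2 := mul_pos htpos (real_inner_self_pos.2 hv0)
  linarith

variable [FiniteDimensional ℝ E] [MeasurableSpace E] [BorelSpace E]

theorem LipschitzWith.addHaar_image_null (μ : Measure E) [μ.IsAddHaarMeasure] {C : ℝ≥0}
    {F : E → E} (hF : LipschitzWith C F) {s : Set E} (hs : μ s = 0) : μ (F '' s) = 0 := by
  have := isAddHaarMeasure_hausdorffMeasure (E := E)
  refine Measure.absolutelyContinuous_isAddHaarMeasure μ (μH[(Module.finrank ℝ E : ℝ)]) ?_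
  have h := hF.hausdorffMeasure_image_le (d := Module.finrank ℝ E) (by positivity) s
  rw [Measure.absolutelyContinuous_isAddHaarMeasure (μH[(Module.finrank ℝ E : ℝ)]) μ hs,
    mul_zero] at h
  exact le_antisymm h zero_le

/-- The area formula for Lipschitz monotone maps: no multiplicity is needed. -/
theorem lintegral_det_fderiv_eq_addHaar_range (μ : Measure E) [μ.IsAddHaarMeasure] {C : ℝ≥0}
    {F : E → E} (hF : LipschitzWith C F) (hmono : ∀ x y, 0 ≤ ⟪F x - F y, x - y⟫) :
    ∫⁻ x, ENNReal.ofReal (fderiv ℝ F x).det ∂μ = μ (range F) := by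
  let D : Set E := {x | DifferentiableAt ℝ F x}
  let S : Set E := {x | (fderiv ℝ F x).det ≠ 0}
  have hD : MeasurableSet D := measurableSet_of_differentiableAt ℝ F
  have hDnull : μ Dᶜ = 0 := hF.ae_differentiableAt
  have hmeas : Measurable fun x => (fderiv ℝ F x).det :=
    ContinuousLinearMap.continuous_det.measurable.comp (measurable_fderiv ℝ F)
  have hS : MeasurableSet S := (measurableSet_eq_fun hmeas measurable_const).compl
  have hinj : InjOn F (D ∩ S) := by
    rintro x ⟨hxD, hxS⟩ y - hxy
    by_contra hne
    have hker : fderiv ℝ F x (y - x) = 0 := by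
      have hlim := (DifferentiableAt.hasFDerivAt hxD).lim_real (y - x)
      refine tendsto_nhds_unique hlim (tendsto_const_nhds.congr' ?_)
      filter_upwards [eventually_ge_atTop 1] with c hc
      rw [apply_add_smul_eq_of_monotone hF.continuous hmono hxy
        (inv_nonneg.2 (zero_le_one.trans hc)) (inv_le_one_of_one_le₀ hc), sub_self, smul_zero]
    refine hne (sub_eq_zero.1 (?_ : y - x = 0)).symm
    have hbij := LinearMap.ker_eq_bot.2 (LinearMap.equivOfDetNeZero _ hxS).injective
    exact LinearMap.ker_eq_bot'.1 hbij _ hker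
  have himage : μ (F '' (D ∩ S)) = μ (range F) := by
    refine le_antisymm (measure_mono (image_subset_range _ _)) ?_
    have hcover : range F ⊆ F '' (D ∩ S) ∪ (F '' (D ∩ Sᶜ) ∪ F '' Dᶜ) := by
      rw [← image_univ, ← image_union, ← image_union]
      refine image_mono fun x _ => ?_
      by_cases h1 : x ∈ D <;> by_cases h2 : x ∈ S <;> simp [h1, h2]
    have h1 : μ (F '' (D ∩ Sᶜ)) = 0 :=
      addHaar_image_eq_zero_of_det_fderivWithin_eq_zero μ (f' := fderiv ℝ F)
        (fun x hx => (DifferentiableAt.hasFDerivAt hx.1).hasFDerivWithinAt)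
        (fun x hx => not_not.1 hx.2)
    calc μ (range F) ≤ μ (F '' (D ∩ S)) + (μ (F '' (D ∩ Sᶜ)) + μ (F '' Dᶜ)) :=
          (measure_mono hcover).trans ((measure_union_le _ _).trans
            (add_le_add le_rfl (measure_union_le _ _)))
      _ = μ (F '' (D ∩ S)) := by rw [h1, hF.addHaar_image_null μ hDnull]; simp
  rw [← himage, ← lintegral_abs_det_fderiv_eq_addHaar_image μ (hD.inter hS)
    (fun x hx => (DifferentiableAt.hasFDerivAt hx.1).hasFDerivWithinAt) hinj,
    ← lintegral_indicator (hD.inter hS)]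
  refine lintegral_congr_ae ?_
  filter_upwards [hF.ae_differentiableAt (μ := μ)] with x hx
  by_cases hxS : x ∈ S
  · rw [indicator_of_mem (show x ∈ D ∩ S from ⟨hx, hxS⟩), abs_of_nonneg]
    exact det_nonneg_of_inner_nonneg (inner_fderiv_nonneg_of_monotone hmono hx.hasFDerivAt)
  · rw [indicator_of_notMem fun h => hxS h.2, not_not.1 hxS, ENNReal.ofReal_zero]

end MonotoneMap

section MinkowskiVolume

variable {E : Type*} [NormedAddCommGroup E] [InnerProductSpace ℝ E] [FiniteDimensional ℝ E]
  {K L : Set E} {P Q : E → E}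

theorem interior_subset_range_of_isNearestPointMap (hP : IsNearestPointMap K P)
    (hQ : IsNearestPointMap L Q) (hK : IsCompact K) (hL : IsCompact L) {a b : ℝ}
    (ha : 0 ≤ a) (hb : 0 ≤ b) :
    interior (a • K + b • L) ⊆ range fun x => a • P x + b • Q x := by
  intro z hz
  obtain ⟨ε, hε, hball⟩ := Metric.nhds_basis_closedBall.mem_iff.1 (mem_interior_iff_mem_nhds.1 hz)
  obtain ⟨R, hR⟩ := hK.isBounded.exists_norm_le
  obtain ⟨S, hS⟩ := hL.isBounded.exists_norm_le
  let ψ : E → ℝ := fun x =>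
    a * nearestPointPotential P x + b * nearestPointPotential Q x - ⟪x, z⟫
  have hψ : Continuous ψ := by
    have := hP.continuous_potential
    have := hQ.continuous_potential
    fun_prop
  have hcoercive : Tendsto ψ (cocompact E) atTop := by
    have hlin : Tendsto (fun x : E => ε * ‖x‖ + -(a * (R ^ 2 / 2) + b * (S ^ 2 / 2)))
        (cocompact E) atTop :=
      tendsto_atTop_add_const_right _ _ (tendsto_norm_cocompact_atTop.const_mul_atTop hε)
    refine tendsto_atTop_mono (fun x => ?_) hlin
    have hw : z + (ε / ‖x‖) • x ∈ a • K + b • L := by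
      apply hball
      rw [mem_closedBall, dist_eq_norm, add_sub_cancel_left, norm_smul, norm_div, norm_norm,
        Real.norm_of_nonneg hε.le]
      rcases eq_or_ne ‖x‖ 0 with h | h
      · simpa [h] using hε.le
      · rw [div_mul_cancel₀ _ h]
    obtain ⟨_, ⟨k, hk, rfl⟩, _, ⟨l, hl, rfl⟩, hkl⟩ := hw
    have hkl' := congrArg (fun w => ⟪x, w⟫) hkl
    simp only [inner_add_right, inner_smul_right, real_inner_self_eq_norm_sq] at hkl'
    have hx : ε / ‖x‖ * ‖x‖ ^ 2 = ε * ‖x‖ := by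
      rcases eq_or_ne ‖x‖ 0 with h | h
      · simp [h]
      · field_simp
    have h1 := mul_le_mul_of_nonneg_left (hP.le_potential x hk) ha
    have h2 := mul_le_mul_of_nonneg_left (hQ.le_potential x hl) hb
    have h3 : a * (‖k‖ ^ 2 / 2) ≤ a * (R ^ 2 / 2) := by
      have := hR k hk
      gcongr
    have h4 : b * (‖l‖ ^ 2 / 2) ≤ b * (S ^ 2 / 2) := by
      have := hS l hl
      gcongr
    simp only [ψ]
    linarith
  obtain ⟨x, hx⟩ := hψ.exists_forall_le hcoercive
  have hcont : Continuous fun x => a • P x + b • Q x := by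
    have := hP.lipschitzWith.continuous
    have := hQ.lipschitzWith.continuous
    fun_prop
  refine ⟨x, eq_of_forall_inner_nonneg hcont fun y => ?_⟩
  have h := hx y
  have h1 := mul_le_mul_of_nonneg_left (hP.potential_sub_le y x) ha
  have h2 := mul_le_mul_of_nonneg_left (hQ.potential_sub_le y x) hb
  rw [inner_sub_left, inner_add_left, real_inner_smul_left, real_inner_smul_left]
  have h3 : ⟪z, y - x⟫ = ⟪y, z⟫ - ⟪x, z⟫ := by
    rw [inner_sub_right, real_inner_comm, real_inner_comm x]
  simp only [ψ] at h
  linarith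

theorem exists_polynomial_det_segment (A B : E →L[ℝ] E) :
    ∃ p : Polynomial ℝ, p.natDegree ≤ Module.finrank ℝ E ∧
      ∀ s, p.eval s = ((1 - s) • A + s • B).det := by
  let e := Module.finBasis ℝ E
  let MA := LinearMap.toMatrix e e (A : E →ₗ[ℝ] E)
  let MB := LinearMap.toMatrix e e (B : E →ₗ[ℝ] E)
  refine ⟨((Polynomial.X : Polynomial ℝ) • (MB - MA).map Polynomial.C + MA.map Polynomial.C).det,
    ?_, fun s => ?_⟩
  · simpa using Polynomial.natDegree_det_X_add_C_le (MB - MA) MA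
  · rw [ContinuousLinearMap.det, ← LinearMap.det_toMatrix e, ← Polynomial.coe_evalRingHom,
      RingHom.map_det]
    congr 1
    ext i j
    simp [MA, MB]
    ring

variable [MeasurableSpace E] [BorelSpace E]

theorem measure_range_nearestPointMap (μ : Measure E) [μ.IsAddHaarMeasure]
    (hP : IsNearestPointMap K P) (hQ : IsNearestPointMap L Q) (hK : IsCompact K)
    (hL : IsCompact L) (hKc : Convex ℝ K) (hLc : Convex ℝ L) {a b : ℝ} (ha : 0 ≤ a) (hb : 0 ≤ b) :
    μ (range fun x => a • P x + b • Q x) = μ (a • K + b • L) := by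
  have hconv : Convex ℝ (a • K + b • L) := (hKc.smul a).add (hLc.smul b)
  refine le_antisymm (measure_mono ?_) ?_
  · rintro _ ⟨x, rfl⟩
    exact add_mem_add (smul_mem_smul_set (hP x).1) (smul_mem_smul_set (hQ x).1)
  · have hclosure : closure (a • K + b • L) =
        interior (a • K + b • L) ∪ frontier (a • K + b • L) := closure_eq_interior_union_frontier _
    calc μ (a • K + b • L)
        ≤ μ (interior (a • K + b • L)) + μ (frontier (a • K + b • L)) :=
          (measure_mono (subset_closure.trans hclosure.subset)).trans (measure_union_le _ _)
      _ = μ (interior (a • K + b • L)) := by rw [hconv.addHaar_frontier μ, add_zero]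
      _ ≤ _ := measure_mono (interior_subset_range_of_isNearestPointMap hP hQ hK hL ha hb)

/-- The volume of `(1 - s) K + s L` as the integral of the Jacobian of the monotone map
`(1 - s) P + s Q`. -/
theorem integral_det_fderiv_nearestPointMap (μ : Measure E) [μ.IsAddHaarMeasure]
    (hP : IsNearestPointMap K P) (hQ : IsNearestPointMap L Q) (hK : IsCompact K)
    (hL : IsCompact L) (hKc : Convex ℝ K) (hLc : Convex ℝ L) {s : ℝ} (hs : s ∈ Icc (0 : ℝ) 1) :
    Integrable (fun x => ((1 - s) • fderiv ℝ P x + s • fderiv ℝ Q x).det) μ ∧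
      ∫ x, ((1 - s) • fderiv ℝ P x + s • fderiv ℝ Q x).det ∂μ =
        (μ ((1 - s) • K + s • L)).toReal := by
  let F : E → E := fun x => (1 - s) • P x + s • Q x
  have hs' : 0 ≤ 1 - s := sub_nonneg.2 hs.2
  have hlip : LipschitzWith (‖1 - s‖₊ * 1 + ‖s‖₊ * 1) F :=
    ((lipschitzWith_smul (1 - s)).comp hP.lipschitzWith).add
      ((lipschitzWith_smul s).comp hQ.lipschitzWith)
  have hmono (x y : E) : 0 ≤ ⟪F x - F y, x - y⟫ := by
    have h1 := mul_nonneg hs' (hP.inner_nonneg x y)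
    have h2 := mul_nonneg hs.1 (hQ.inner_nonneg x y)
    rw [add_sub_add_comm, ← smul_sub, ← smul_sub, inner_add_left, real_inner_smul_left,
      real_inner_smul_left]
    exact add_nonneg h1 h2
  have hfderiv : (fun x => (fderiv ℝ F x).det) =ᵐ[μ]
      fun x => ((1 - s) • fderiv ℝ P x + s • fderiv ℝ Q x).det := by
    filter_upwards [hP.lipschitzWith.ae_differentiableAt (μ := μ),
      hQ.lipschitzWith.ae_differentiableAt (μ := μ)] with x hPx hQx
    have hd : HasFDerivAt F ((1 - s) • fderiv ℝ P x + s • fderiv ℝ Q x) x :=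
      (hPx.hasFDerivAt.const_smul (1 - s)).add (hQx.hasFDerivAt.const_smul s)
    rw [hd.fderiv]
  have hmeas : AEStronglyMeasurable (fun x => (fderiv ℝ F x).det) μ :=
    (ContinuousLinearMap.continuous_det.measurable.comp
      (measurable_fderiv ℝ F)).aestronglyMeasurable
  have hnonneg : 0 ≤ᵐ[μ] fun x => (fderiv ℝ F x).det := by
    filter_upwards [hlip.ae_differentiableAt (μ := μ)] with x hx
    exact det_nonneg_of_inner_nonneg (inner_fderiv_nonneg_of_monotone hmono hx.hasFDerivAt)
  have hlint : ∫⁻ x, ENNReal.ofReal (fderiv ℝ F x).det ∂μ = μ ((1 - s) • K + s • L) := by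
    rw [lintegral_det_fderiv_eq_addHaar_range μ hlip hmono,
      ← measure_range_nearestPointMap μ hP hQ hK hL hKc hLc hs' hs.1]
  rw [← integral_congr_ae hfderiv, ← integrable_congr hfderiv]
  constructor
  · rw [← lintegral_ofReal_ne_top_iff_integrable hmeas hnonneg, hlint]
    exact ((hK.smul (1 - s)).add (hL.smul s)).measure_ne_top
  · rw [integral_eq_lintegral_of_nonneg_ae hnonneg hmeas, hlint]

/-- **Minkowski's theorem** on a segment of convex bodies: the volume of `(1 - s) K + s L` is a
polynomial in `s` of degree at most the dimension. -/
theorem exists_polynomial_measure_segment (μ : Measure E) [μ.IsAddHaarMeasure]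
    (hKne : K.Nonempty) (hK : IsCompact K) (hKc : Convex ℝ K)
    (hLne : L.Nonempty) (hL : IsCompact L) (hLc : Convex ℝ L) :
    ∃ g : Polynomial ℝ, g.natDegree ≤ Module.finrank ℝ E ∧
      ∀ s ∈ Icc (0 : ℝ) 1, (μ ((1 - s) • K + s • L)).toReal = g.eval s := by
  obtain ⟨P, hP⟩ := exists_isNearestPointMap hKne hK hKc
  obtain ⟨Q, hQ⟩ := exists_isNearestPointMap hLne hL hLc
  have hintegral (s : ℝ) (hs : s ∈ Icc (0 : ℝ) 1) :=
    integral_det_fderiv_nearestPointMap μ hP hQ hK hL hKc hLc hs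
  generalize hd : Module.finrank ℝ E = d
  let t : Finset ℕ := Finset.range (d + 1)
  let v : ℕ → ℝ := fun i => i / (d + 1)
  have hvinj : InjOn v t := fun i _ j _ hij => by
    have : (d : ℝ) + 1 ≠ 0 := by positivity
    simpa [v, div_left_inj' this] using hij
  have hvmem (i : ℕ) (hi : i ∈ t) : v i ∈ Icc (0 : ℝ) 1 := by
    refine ⟨by positivity, div_le_one_of_le₀ ?_ (by positivity)⟩
    exact_mod_cast (Finset.mem_range.1 hi).le
  refine ⟨Lagrange.interpolate t v fun i => (μ ((1 - v i) • K + v i • L)).toReal, ?_,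
    fun s hs => ?_⟩
  · have hdeg := Lagrange.degree_interpolate_lt
      (fun i => (μ ((1 - v i) • K + v i • L)).toReal) hvinj
    rw [Finset.card_range] at hdeg
    exact Polynomial.natDegree_le_of_degree_le (Order.le_of_lt_succ hdeg)
  · have hexpand (x : E) : ((1 - s) • fderiv ℝ P x + s • fderiv ℝ Q x).det =
        ∑ i ∈ t, ((1 - v i) • fderiv ℝ P x + v i • fderiv ℝ Q x).det *
          (Lagrange.basis t v i).eval s := by
      obtain ⟨p, hpdeg, hp⟩ := exists_polynomial_det_segment (fderiv ℝ P x) (fderiv ℝ Q x)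
      have hplt : p.degree < t.card := by
        rw [Finset.card_range]
        exact (Polynomial.degree_le_of_natDegree_le (hpdeg.trans hd.le)).trans_lt
          (by exact_mod_cast d.lt_succ_self)
      have := congrArg (Polynomial.eval s) (Lagrange.eq_interpolate hvinj hplt)
      rw [Lagrange.interpolate_apply, Polynomial.eval_finsetSum] at this
      simpa only [hp, Polynomial.eval_mul, Polynomial.eval_C] using this
    rw [← (hintegral s hs).2, Lagrange.interpolate_apply, Polynomial.eval_finsetSum,
      integral_congr_ae (ae_of_all μ hexpand),
      integral_finsetSum _ fun i hi => (hintegral _ (hvmem i hi)).1.mul_const _]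
    refine Finset.sum_congr rfl fun i hi => ?_
    rw [integral_mul_const, (hintegral _ (hvmem i hi)).2, Polynomial.eval_mul, Polynomial.eval_C]

/-- **Minkowski's theorem**: the volume of `a K + b L` is a homogeneous polynomial in the
nonnegative coefficients `a`, `b`. -/
theorem exists_homogeneous_measure_add_smul (μ : Measure E) [μ.IsAddHaarMeasure]
    (hKne : K.Nonempty) (hK : IsCompact K) (hKc : Convex ℝ K)
    (hLne : L.Nonempty) (hL : IsCompact L) (hLc : Convex ℝ L) :
    ∃ q : ℕ → ℝ, ∀ a b : ℝ, 0 ≤ a → 0 ≤ b → 0 < a + b →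
      (μ (a • K + b • L)).toReal = ∑ i ∈ Finset.range (Module.finrank ℝ E + 1),
        q i * b ^ i * (a + b) ^ (Module.finrank ℝ E - i) := by
  obtain ⟨g, hgdeg, hg⟩ := exists_polynomial_measure_segment μ hKne hK hKc hLne hL hLc
  refine ⟨g.coeff, fun a b ha hb hab => ?_⟩
  have hs : b / (a + b) ∈ Icc (0 : ℝ) 1 :=
    ⟨by positivity, div_le_one_of_le₀ (by linarith) hab.le⟩
  have hset : a • K + b • L = (a + b) • ((1 - b / (a + b)) • K + (b / (a + b)) • L) := by
    rw [smul_add, smul_smul, smul_smul]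
    congr 2
    all_goals field_simp
    ring
  rw [hset, Measure.addHaar_smul, ENNReal.toReal_mul, hg _ hs, abs_of_nonneg (by positivity),
    ENNReal.toReal_ofReal (by positivity),
    Polynomial.eval_eq_sum_range' (Nat.lt_succ_of_le hgdeg), Finset.mul_sum]
  refine Finset.sum_congr rfl fun i hi => ?_
  have hi' : i ≤ Module.finrank ℝ E := Nat.lt_succ_iff.1 (Finset.mem_range.1 hi)
  rw [← Nat.sub_add_cancel hi', pow_add, Nat.sub_add_cancel hi', div_pow]
  field_simp

end MinkowskiVolume

section Cancellation

variable {E : Type*} [NormedAddCommGroup E] [NormedSpace ℝ E]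

/-- The cancellation law for Minkowski sums with a compact set. -/
theorem mem_of_add_singleton_subset_add {K M : Set E} (hKne : K.Nonempty) (hK : IsCompact K)
    (hM : IsClosed M) (hMc : Convex ℝ M) {v : E} (hv : K + {v} ⊆ M + K) : v ∈ M := by
  by_contra hvM
  obtain ⟨f, u, hfM, hfv⟩ := geometric_hahn_banach_closed_point hMc hM hvM
  obtain ⟨k, hk, hmax⟩ := hK.exists_isMaxOn hKne f.continuous.continuousOn
  obtain ⟨m, hm, k', hk', hsum⟩ := hv (add_mem_add hk (mem_singleton v))
  have h := congrArg f hsum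
  simp only [map_add] at h
  have := hfM m hm
  have : f k' ≤ f k := hmax hk'
  linarith

end Cancellation

theorem minkowskiDiff_add_eq_left {n : ℕ} {K M : Set (EuclideanSpace ℝ (Fin n))}
    (hKne : K.Nonempty) (hK : IsCompact K) (hM : IsCompact M) (hMc : Convex ℝ M) :
    minkowskiDiff (M + K) K = M := by
  ext v
  refine ⟨fun hv => mem_of_add_singleton_subset_add hKne hK hM.isClosed hMc hv, fun hv => ?_⟩
  change K + {v} ⊆ M + K
  rw [add_comm M K]
  exact add_subset_add_left (singleton_subset_iff.2 hv)

/-- If the convex body `K` is a Minkowski summand of `cB` and `P` is the Steiner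
polynomial of `K`, then the Steiner polynomial of `K' = cB ∼ K` satisfies
`S_{K'}(t) = (-1)ⁿ P(-t - c)`. -/
theorem steiner_polynomial_complement_body (n : ℕ)
    (K : Set (EuclideanSpace ℝ (Fin n)))
    (hKne : K.Nonempty) (hKcomp : IsCompact K) (hKconv : Convex ℝ K)
    (c : ℝ) (hc : 0 < c)
    (hsummand : ∃ M : Set (EuclideanSpace ℝ (Fin n)), M.Nonempty ∧ IsCompact M ∧
      Convex ℝ M ∧ M + K = c • closedBall (0 : EuclideanSpace ℝ (Fin n)) 1)
    (P : Polynomial ℝ) (hPdeg : P.natDegree ≤ n)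
    (hP : ∀ t : ℝ, 0 ≤ t →
      P.eval t = (volume (K + t • closedBall (0 : EuclideanSpace ℝ (Fin n)) 1)).toReal) :
    ∀ t : ℝ, 0 ≤ t →
      (volume (minkowskiDiff (c • closedBall (0 : EuclideanSpace ℝ (Fin n)) 1) K
          + t • closedBall (0 : EuclideanSpace ℝ (Fin n)) 1)).toReal
        = (-1 : ℝ) ^ n * P.eval (-t - c) := by
  intro t ht
  obtain ⟨M, hMne, hM, hMc, hsum⟩ := hsummand
  set B := closedBall (0 : EuclideanSpace ℝ (Fin n)) 1
  obtain ⟨q, hq⟩ := exists_homogeneous_measure_add_smul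
    (volume : Measure (EuclideanSpace ℝ (Fin n))) hMne hM hMc hKne hKcomp hKconv
  rw [finrank_euclideanSpace_fin] at hq
  have hB (t : ℝ) : t • B = (t / c) • M + (t / c) • K := by
    rw [← smul_add, hsum, smul_smul, div_mul_cancel₀ _ hc.ne']
  have hKB (t : ℝ) (ht : 0 ≤ t) : K + t • B = (t / c) • M + (1 + t / c) • K := by
    rw [hB, hKconv.add_smul zero_le_one (by positivity), one_smul, add_left_comm]
  have hMB : M + t • B = (1 + t / c) • M + (t / c) • K := by
    rw [hB, hMc.add_smul zero_le_one (by positivity), one_smul, add_assoc]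
  let R : Polynomial ℝ := ∑ i ∈ Finset.range (n + 1), Polynomial.C (q i) *
    (1 + Polynomial.C c⁻¹ * Polynomial.X) ^ i *
      (1 + Polynomial.C (2 * c⁻¹) * Polynomial.X) ^ (n - i)
  have hR (t : ℝ) : R.eval t =
      ∑ i ∈ Finset.range (n + 1), q i * (1 + t / c) ^ i * (1 + 2 * (t / c)) ^ (n - i) := by
    simp only [R, Polynomial.eval_finsetSum, Polynomial.eval_mul, Polynomial.eval_pow,
      Polynomial.eval_add, Polynomial.eval_one, Polynomial.eval_C, Polynomial.eval_X]
    refine Finset.sum_congr rfl fun i _ => ?_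
    ring
  have hPR : P = R := by
    refine Polynomial.eq_of_infinite_eval_eq P R ((Ici_infinite (0 : ℝ)).mono fun t ht => ?_)
    have ht : 0 ≤ t := ht
    change P.eval t = R.eval t
    rw [hP t ht, hKB t ht, hq _ _ (by positivity) (by positivity) (by positivity), hR]
    refine Finset.sum_congr rfl fun i _ => ?_
    ring
  rw [← hsum, minkowskiDiff_add_eq_left hKne hKcomp hM hMc, hMB,
    hq _ _ (by positivity) (by positivity) (by positivity), hPR, hR, Finset.mul_sum]
  refine Finset.sum_congr rfl fun i hi => ?_
  have hi' : i ≤ n := Nat.lt_succ_iff.1 (Finset.mem_range.1 hi)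
  have h1 : 1 + (-t - c) / c = -1 * (t / c) := by
    field_simp
    ring
  have h2 : 1 + 2 * ((-t - c) / c) = -1 * (1 + t / c + t / c) := by
    field_simp
    ring
  have h3 : (-1 : ℝ) ^ i * (-1) ^ (n - i) = (-1) ^ n := by
    rw [← pow_add, Nat.add_sub_cancel' hi']
  have h4 : (-1 : ℝ) ^ n * (-1) ^ n = 1 := by
    rw [← mul_pow]
    norm_num
  rw [h1, h2, mul_pow, mul_pow]
  calc q i * (t / c) ^ i * (1 + t / c + t / c) ^ (n - i)
      = ((-1) ^ n * (-1) ^ n) * (q i * (t / c) ^ i * (1 + t / c + t / c) ^ (n - i)) := by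
        rw [h4, one_mul]
    _ = ((-1) ^ n * ((-1 : ℝ) ^ i * (-1) ^ (n - i))) *
          (q i * (t / c) ^ i * (1 + t / c + t / c) ^ (n - i)) := by rw [h3]
    _ = _ := by ring
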